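/- Let A_0A_1…A_m (m ≥ 1) be a broken line in ℝ² with LLS-sequence (a_0, a_1, …, a_{2m−2}) with respect to the origin, with A_0 = (1,0) and A_1 = (1, a_0), and let p_k, q_k be the continuants of (a_0,…,a_{2m−2}). Then the broken line is closed (i.e., A_m = A_0) if and only if q_{2m−2} = 1 and p_{2m−2} = 0. -/

import Mathlib

/-- Oriented area of the parallelogram spanned by two vectors of `ℝ²`. -/
def cross (v w : ℝ × ℝ) : ℝ := v.1 * w.2 - v.2 * w.1

/-- Edge elements of an LLS-sequence: `a (2k) = A k × A (k+1)`. -/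
def edgeElem (A : ℕ → ℝ × ℝ) (k : ℕ) : ℝ := cross (A k) (A (k + 1))

/-- Angle elements of an LLS-sequence:
`a (2k-1) = ((A (k-1) - A k) × (A (k+1) - A k)) / (a (2k-2) * a (2k))`. -/
noncomputable def angleElem (A : ℕ → ℝ × ℝ) (k : ℕ) : ℝ :=
  cross (A (k - 1) - A k) (A (k + 1) - A k) / (edgeElem A (k - 1) * edgeElem A k)

/-- The LLS-sequence of a broken line `A` with respect to the origin:
`lls A (2k) = edgeElem A k` and `lls A (2k-1) = angleElem A k`. -/
noncomputable def lls (A : ℕ → ℝ × ℝ) (j : ℕ) : ℝ :=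
  if j % 2 = 0 then edgeElem A (j / 2) else angleElem A ((j + 1) / 2)

/-- Continuant numerators `p k` of a sequence `a`:
`p (-2) = 0`, `p (-1) = 1`, `p k = a k * p (k-1) + p (k-2)`. -/
def contP (a : ℕ → ℝ) : ℕ → ℝ
  | 0 => a 0
  | 1 => a 1 * a 0 + 1
  | (k + 2) => a (k + 2) * contP a (k + 1) + contP a k

/-- Continuant denominators `q k` of a sequence `a`:
`q (-2) = 1`, `q (-1) = 0`, `q k = a k * q (k-1) + q (k-2)`. -/
def contQ (a : ℕ → ℝ) : ℕ → ℝ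
  | 0 => 1
  | 1 => a 1
  | (k + 2) => a (k + 2) * contQ a (k + 1) + contQ a k

theorem lls_two_mul (A : ℕ → ℝ × ℝ) (k : ℕ) : lls A (2 * k) = edgeElem A k := by
  simp [lls]

theorem lls_two_mul_add_one (A : ℕ → ℝ × ℝ) (k : ℕ) :
    lls A (2 * k + 1) = angleElem A (k + 1) := by
  have h₁ : (2 * k + 1) % 2 = 1 := by omega
  have h₂ : (2 * k + 1 + 1) / 2 = k + 1 := by omega
  simp [lls, h₁, h₂]

/-- The angle element expresses each edge of the broken line through the preceding edge and
the vertex they share. -/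
theorem edge_recurrence (A : ℕ → ℝ × ℝ) (k : ℕ)
    (h₀ : edgeElem A k ≠ 0) (h₁ : edgeElem A (k + 1) ≠ 0) :
    edgeElem A k • (A (k + 2) - A (k + 1)) =
      (edgeElem A k * edgeElem A (k + 1) * angleElem A (k + 1)) • A (k + 1) +
        edgeElem A (k + 1) • (A (k + 1) - A k) := by
  have h : edgeElem A k * edgeElem A (k + 1) * angleElem A (k + 1) =
      cross (A k - A (k + 1)) (A (k + 2) - A (k + 1)) := by
    simp only [angleElem, Nat.add_sub_cancel]
    exact mul_div_cancel₀ _ (mul_ne_zero h₀ h₁)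
  rw [h]
  ext <;> simp [edgeElem, cross] <;> ring

/-- The vertices of a broken line are given by the even-indexed continuants of its
LLS-sequence, and its edges are multiples of the odd-indexed ones. -/
theorem vertex_eq_continuants {m : ℕ} {A : ℕ → ℝ × ℝ}
    (hA : ∀ k < m, edgeElem A k ≠ 0) (hA0 : A 0 = (1, 0)) (hA1 : A 1 = (1, lls A 0)) :
    ∀ k < m, A (k + 1) = (contQ (lls A) (2 * k), contP (lls A) (2 * k)) ∧
      edgeElem A k • ((contQ (lls A) (2 * k + 1), contP (lls A) (2 * k + 1)) -
        lls A (2 * k + 1) • A (k + 1)) = A (k + 1) - A k := by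
  intro k
  induction k with
  | zero =>
    intro _
    have h : edgeElem A 0 = lls A 0 := (lls_two_mul A 0).symm
    refine ⟨by simpa [contQ, contP] using hA1, ?_⟩
    simp [contQ, contP, hA0, hA1, h]
  | succ k ih =>
    intro hk
    obtain ⟨hv, he⟩ := ih (by omega)
    have h₀ := hA k (by omega)
    have hr := edge_recurrence A k h₀ (hA (k + 1) hk)
    rw [lls_two_mul_add_one] at he
    have hQ : contQ (lls A) (2 * (k + 1)) =
        edgeElem A (k + 1) * contQ (lls A) (2 * k + 1) + contQ (lls A) (2 * k) := by
      rw [← lls_two_mul]; rfl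
    have hP : contP (lls A) (2 * (k + 1)) =
        edgeElem A (k + 1) * contP (lls A) (2 * k + 1) + contP (lls A) (2 * k) := by
      rw [← lls_two_mul]; rfl
    have hedge : edgeElem A (k + 1) •
        (contQ (lls A) (2 * k + 1), contP (lls A) (2 * k + 1)) = A (k + 2) - A (k + 1) := by
      apply smul_right_injective _ h₀
      simp only
      rw [hr, ← he]
      module
    have hv' : A (k + 2) = (contQ (lls A) (2 * (k + 1)), contP (lls A) (2 * (k + 1))) := by
      rw [eq_sub_iff_add_eq, hv] at hedge
      rw [← hedge, hQ, hP]
      simp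
    refine ⟨hv', ?_⟩
    have hstep : (contQ (lls A) (2 * (k + 1) + 1), contP (lls A) (2 * (k + 1) + 1)) =
        lls A (2 * (k + 1) + 1) • A (k + 2) +
          (contQ (lls A) (2 * k + 1), contP (lls A) (2 * k + 1)) := by
      rw [hv']; rfl
    rw [hstep, add_sub_cancel_left, hedge]

/-- **Closedness condition for broken lines.**
Let `A 0 A 1 … A m` be a broken line with LLS-sequence `(a 0, …, a (2m-2))` with respect to
the origin, with `A 0 = (1,0)` and `A 1 = (1, a 0)`. Then the broken line is closed
(`A m = A 0`) if and only if `q (2m-2) = 1` and `p (2m-2) = 0`, where `p`, `q` are the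
continuants of the LLS-sequence. -/
theorem closed_iff_continuants
    (m : ℕ) (hm : 1 ≤ m) (A : ℕ → ℝ × ℝ)
    (hA : ∀ k < m, cross (A k) (A (k + 1)) ≠ 0)
    (hA0 : A 0 = (1, 0))
    (hA1 : A 1 = (1, lls A 0)) :
    A m = A 0 ↔
      contQ (lls A) (2 * m - 2) = 1 ∧ contP (lls A) (2 * m - 2) = 0 := by
  obtain ⟨k, rfl⟩ : ∃ k, m = k + 1 := ⟨m - 1, by omega⟩
  have hk : 2 * (k + 1) - 2 = 2 * k := by omega
  rw [hk, (vertex_eq_continuants hA hA0 hA1 k (by omega)).1, hA0, Prod.mk.injEq]
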